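/- Let 𝐢 be a Lyndon word, 𝐣 a dominant word with 𝐢 ≻ 𝐣, and m a positive integer. Then max(𝐣 ⋄ 𝐢^{⋄m}) = 𝐢^m𝐣, and the coefficient of 𝐢^m𝐣 in 𝐣 ⋄ 𝐢^{⋄m} equals (−1)^{m(m−1)p(𝐢)/2} q_𝐢^{−m(m−1)/2} [m]_𝐢!, where 𝐢^{⋄m} denotes the m-fold quantum shuffle power of 𝐢. -/

import Mathlib

namespace SpinQHA

/-- The coefficient field `ℚ(q)`. -/
abbrev Kq : Type := RatFunc ℚ

/-- The variable `q`. -/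
noncomputable def qX : Kq := RatFunc.X

/-- Parity of the letter `i`.  The alphabet is `Fin (n+2)` (so the rank is `n+2 ≥ 2`);
the index `i` represents the letter `i+1`, and the last letter is the unique odd one. -/
def pa (n : ℕ) (i : Fin (n+2)) : ℕ := if (i : ℕ) = n+1 then 1 else 0

/-- Symmetrized Cartan matrix of `osp(1|2(n+2))`. -/
def cart (n : ℕ) (i j : Fin (n+2)) : ℤ :=
  if i = j then (if (i : ℕ) = n+1 then 2 else 4)
  else if (i : ℕ) + 1 = (j : ℕ) ∨ (j : ℕ) + 1 = (i : ℕ) then -2 else 0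

/-- Bilinear form on `Q⁺` (elements recorded by their coordinates). -/
def bil (n : ℕ) (μ ν : Fin (n+2) → ℕ) : ℤ :=
  ∑ i, ∑ j, (μ i : ℤ) * (ν j : ℤ) * cart n i j

/-- Weight `|w| ∈ Q⁺` of a word. -/
def wt (n : ℕ) (w : List (Fin (n+2))) : Fin (n+2) → ℕ := fun i => w.count i

/-- Parity (as a natural number, read mod 2) of a word. -/
def pw (n : ℕ) (w : List (Fin (n+2))) : ℕ := (w.map (pa n)).sum

/-- `F`, the free `ℚ(q)`-module on the set of words. -/
abbrev F (n : ℕ) : Type := List (Fin (n+2)) →₀ Kq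

/-- Quantum shuffle of two words, computed in the "reversed" representation where the
head of each list is the *last* letter of the corresponding word; this encodes the
inductive rule `(xi) ⋄ (yj) = (x ⋄ (yj))i + (-1)^{p(xi)p(j)} q^{-(|xi|,|j|)} ((xi) ⋄ y)j`. -/
noncomputable def shAux (n : ℕ) : List (Fin (n+2)) → List (Fin (n+2)) → F n
  | [], y => Finsupp.single y 1
  | x, [] => Finsupp.single x 1
  | i :: x, j :: y =>
      Finsupp.mapDomain (List.cons i) (shAux n x (j :: y))
      + ((-1 : Kq) ^ (pw n (i :: x) * pa n j)
          * qX ^ (-(bil n (wt n (i :: x)) (wt n [j])))) •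
          Finsupp.mapDomain (List.cons j) (shAux n (i :: x) y)
  termination_by x y => x.length + y.length

/-- Quantum shuffle product of two words. -/
noncomputable def shw (n : ℕ) (x y : List (Fin (n+2))) : F n :=
  Finsupp.mapDomain List.reverse (shAux n x.reverse y.reverse)

/-- The quantum shuffle product `⋄` on `F`, extended bilinearly. -/
noncomputable def diam (n : ℕ) (u v : F n) : F n :=
  u.sum fun x cx => v.sum fun y cy => (cx * cy) • shw n x y

/-- Strict lexicographic order `≺` on words. -/
def wlt (n : ℕ) (v w : List (Fin (n+2))) : Prop := List.Lex (· < ·) v w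

/-- A word is Lyndon if it is nonempty and lexicographically smaller than each of its
proper nonempty suffixes. -/
def IsLyndonW (n : ℕ) (w : List (Fin (n+2))) : Prop :=
  w ≠ [] ∧ ∀ s t : List (Fin (n+2)), w = s ++ t → s ≠ [] → t ≠ [] → wlt n w t

/-- Iterated shuffle products of one-letter words. -/
noncomputable def prodLetters (n : ℕ) : List (Fin (n+2)) → F n
  | [] => Finsupp.single [] 1
  | i :: l => diam n (Finsupp.single [i] 1) (prodLetters n l)

/-- `U`, the subalgebra of `(F,⋄)` generated by the one-letter words, realized as the
`ℚ(q)`-span of all iterated shuffle products of letters. -/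
noncomputable def Ualg (n : ℕ) : Submodule Kq (F n) :=
  Submodule.span Kq (Set.range (prodLetters n))

/-- `w = max(u)`: `w` is the lexicographically largest word occurring in `u` with
nonzero coefficient. -/
def IsMaxWord (n : ℕ) (u : F n) (w : List (Fin (n+2))) : Prop :=
  w ∈ u.support ∧ ∀ v ∈ u.support, v = w ∨ wlt n v w

/-- A word is dominant if it is the largest word of some `u ∈ U`. -/
def IsDominant (n : ℕ) (w : List (Fin (n+2))) : Prop :=
  ∃ u ∈ Ualg n, IsMaxWord n u w

/-- The `m`-fold concatenation `w^m` of a word. -/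
def rep (n : ℕ) (m : ℕ) (w : List (Fin (n+2))) : List (Fin (n+2)) :=
  (List.replicate m w).flatten

/-- `q_𝐢 = q^{(|𝐢|,|𝐢|)/2}`. -/
noncomputable def qI (n : ℕ) (w : List (Fin (n+2))) : Kq :=
  qX ^ ((bil n (wt n w) (wt n w)) / 2)

/-- The (signed) quantum integer `[m]_𝐢`:
`[m]_𝐢 = (q_𝐢^m - q_𝐢^{-m})/(q_𝐢 - q_𝐢^{-1})` if `p(𝐢) = 0̄`, and
`[m]_𝐢 = ((-q_𝐢)^m - q_𝐢^{-m})/(-q_𝐢 - q_𝐢^{-1})` if `p(𝐢) = 1̄`. -/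
noncomputable def qint (n : ℕ) (w : List (Fin (n+2))) (m : ℕ) : Kq :=
  if pw n w % 2 = 0 then
    (qI n w ^ m - (qI n w)⁻¹ ^ m) / (qI n w - (qI n w)⁻¹)
  else
    ((-qI n w) ^ m - (qI n w)⁻¹ ^ m) / (-qI n w - (qI n w)⁻¹)

/-- The quantum factorial `[m]_𝐢! = [m]_𝐢 [m-1]_𝐢 ⋯ [1]_𝐢`. -/
noncomputable def qfact (n : ℕ) (w : List (Fin (n+2))) : ℕ → Kq
  | 0 => 1
  | m + 1 => qint n w (m+1) * qfact n w m

/-- The `m`-fold quantum shuffle power `w^{⋄m}` of a word. -/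
noncomputable def shPow (n : ℕ) (w : List (Fin (n+2))) : ℕ → F n
  | 0 => Finsupp.single [] 1
  | m + 1 => diam n (shPow n w m) (Finsupp.single w 1)

section Shuffle
variable {α : Type*}

/-- `IsShuffle u v z`: the word `z` is a shuffle of `u` and `v`. -/
inductive IsShuffle : List α → List α → List α → Prop
  | nil : IsShuffle [] [] []
  | left {u v z : List α} (a : α) : IsShuffle u v z → IsShuffle (a :: u) v (a :: z)
  | right {u v z : List α} (a : α) : IsShuffle u v z → IsShuffle u (a :: v) (a :: z)

namespace IsShuffle

theorem length_eq {u v z : List α} (h : IsShuffle u v z) :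
    z.length = u.length + v.length := by
  induction h <;> simp_all <;> omega

theorem symm {u v z : List α} (h : IsShuffle u v z) : IsShuffle v u z := by
  induction h with
  | nil => exact nil
  | left a _ ih => exact ih.right a
  | right a _ ih => exact ih.left a

theorem eq_of_nil_left {v z : List α} (h : IsShuffle [] v z) : z = v := by
  generalize hu : ([] : List α) = u at h
  induction h with
  | nil => rfl
  | left => cases hu
  | right a _ ih => rw [ih hu]

theorem concat_left {u v z : List α} (h : IsShuffle u v z) (a : α) :
    IsShuffle (u ++ [a]) v (z ++ [a]) := by
  induction h with
  | nil => exact nil.left a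
  | left b _ ih => exact ih.left b
  | right b _ ih => exact ih.right b

theorem reverse {u v z : List α} (h : IsShuffle u v z) :
    IsShuffle u.reverse v.reverse z.reverse := by
  induction h with
  | nil => exact nil
  | left a _ ih => simpa using ih.concat_left a
  | right a _ ih => simpa using (ih.symm.concat_left a).symm

theorem split {z₁ z₂ : List α} : ∀ {u v : List α}, IsShuffle u v (z₁ ++ z₂) →
    ∃ u₁ u₂ v₁ v₂, u = u₁ ++ u₂ ∧ v = v₁ ++ v₂ ∧ IsShuffle u₁ v₁ z₁ ∧ IsShuffle u₂ v₂ z₂ := by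
  induction z₁ with
  | nil => exact fun {u v} h => ⟨[], u, [], v, rfl, rfl, nil, h⟩
  | cons c z ih =>
    intro u v h
    cases h with
    | left _ h =>
      obtain ⟨u₁, u₂, v₁, v₂, rfl, rfl, h₁, h₂⟩ := ih h
      exact ⟨c :: u₁, u₂, v₁, v₂, rfl, rfl, h₁.left c, h₂⟩
    | right _ h =>
      obtain ⟨u₁, u₂, v₁, v₂, rfl, rfl, h₁, h₂⟩ := ih h
      exact ⟨u₁, u₂, c :: v₁, v₂, rfl, rfl, h₁.right c, h₂⟩

end IsShuffle

theorem exists_split_of_le_length {z : List α} {k : ℕ} (h : k ≤ z.length) :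
    ∃ z₁ z₂, z = z₁ ++ z₂ ∧ z₁.length = k :=
  ⟨z.take k, z.drop k, by simp, by simp [h]⟩

end Shuffle

section Lex
variable {α : Type*} [LinearOrder α]

theorem append_lt_append_left_iff (p a b : List α) : p ++ a < p ++ b ↔ a < b := by
  induction p with
  | nil => rfl
  | cons x p ih => simp [ih]

theorem lt_append_of_ne_nil (a : List α) {t : List α} (ht : t ≠ []) : a < a ++ t := by
  have := (append_lt_append_left_iff a [] t).2 (by cases t <;> simp_all)
  simpa using this

theorem prefix_lt {a b t : List α} (h : a ++ t < b) : a < b := by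
  rcases eq_or_ne t [] with rfl | ht
  · simpa using h
  · exact (lt_append_of_ne_nil a ht).trans h

theorem append_lt_append_of_not_prefix : ∀ {a b : List α} (c d : List α), a < b →
    ¬ a <+: b → a ++ c < b ++ d
  | _, [], _, _, h, _ => absurd h (List.not_lt_nil _)
  | [], _ :: _, _, _, _, hl => by simp at hl
  | x :: a, y :: b, c, d, h, hl => by
    simp only [List.cons_append, List.cons_lt_cons_iff] at h ⊢
    rcases h with h | ⟨rfl, h⟩
    · exact .inl h
    · exact .inr ⟨rfl, append_lt_append_of_not_prefix c d h
        (by simpa [List.cons_prefix_cons] using hl)⟩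

theorem append_lt_append_of_lt {a b : List α} (c d : List α) (h : a < b)
    (hl : b.length ≤ a.length) : a ++ c < b ++ d :=
  append_lt_append_of_not_prefix c d h fun hp => h.ne (hp.eq_of_length_le hl)

/-- A Lyndon word over an arbitrary linearly ordered alphabet. -/
def Lyndon (w : List α) : Prop :=
  w ≠ [] ∧ ∀ s t : List α, w = s ++ t → s ≠ [] → t ≠ [] → w < t

/-- A Lyndon word of length at least two is a product of two Lyndon words. -/
theorem Lyndon.exists_factorization {w : List α} (hw : Lyndon w) (h2 : 2 ≤ w.length) :
    ∃ u v, w = u ++ v ∧ Lyndon u ∧ Lyndon v := by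
  let S : Finset (List α) := (Finset.Icc 1 (w.length - 1)).image fun k => w.drop k
  have hS : S.Nonempty := ⟨w.drop 1, Finset.mem_image_of_mem _ (by simp; omega)⟩
  have mem : ∀ s t, w = s ++ t → s ≠ [] → t ≠ [] → t ∈ S := by
    intro s t h hs ht
    refine Finset.mem_image.2 ⟨s.length, ?_, by simp [h]⟩
    have := List.length_pos_of_ne_nil hs
    have := List.length_pos_of_ne_nil ht
    simp [h]; omega
  obtain ⟨v, hv, hmin⟩ := S.exists_min_image id hS
  obtain ⟨k, hk, rfl⟩ := Finset.mem_image.1 hv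
  rw [Finset.mem_Icc] at hk
  have huv : w = w.take k ++ w.drop k := (List.take_append_drop k w).symm
  have hu0 : w.take k ≠ [] := by
    intro h; have := congrArg List.length h; simp at this; rcases this with h | h <;> grind
  have hv0 : w.drop k ≠ [] := by
    intro h; have := congrArg List.length h; simp at this; omega
  generalize w.take k = u at *
  generalize w.drop k = v at *
  refine ⟨u, v, huv, ⟨hu0, ?_⟩, ⟨hv0, ?_⟩⟩
  · rintro s t rfl hs ht
    by_contra hlt
    have h1 : (s ++ t) ++ v < t ++ v := by
      rw [← huv]; exact hw.2 s (t ++ v) (by simp [huv]) hs (by simp [ht])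
    rcases lt_or_eq_of_le (not_lt.1 hlt) with h | h
    · by_cases hp : t <+: s ++ t
      · obtain ⟨r, hr⟩ := hp
        have hr0 : r ≠ [] := by
          rintro rfl
          simp at hr; exact hs hr
        rw [← hr, List.append_assoc, append_lt_append_left_iff] at h1
        have := hmin (r ++ v) (mem t (r ++ v) (by rw [huv, ← hr]; simp) ht (by simp [hv0]))
        exact absurd h1 (not_lt.2 this)
      · exact lt_asymm h1 (append_lt_append_of_not_prefix v v h hp)
    · have := congrArg List.length h
      have hs' := List.length_pos_of_ne_nil hs
      simp at this
      exact hs this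
  · rintro s t rfl hs ht
    refine lt_of_le_of_ne (hmin t (mem (u ++ s) t (by simp [huv]) (by simp [hs]) ht)) ?_
    intro h
    simpa [hs] using congrArg List.length h

/-- Words below a Lyndon word are closed under shuffling. -/
theorem Lyndon.shuffle_lt {i : List α} (hi : Lyndon i) {u v z : List α} (hu : u < i)
    (hv : v < i) (h : IsShuffle u v z) : z < i := by
  induction hn : i.length using Nat.strong_induction_on generalizing i u v z with
  | _ n ih =>
  subst hn
  by_cases h2 : 2 ≤ i.length
  · obtain ⟨i₁, i₂, rfl, hi₁, hi₂⟩ := hi.exists_factorization h2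
    have l₁ := List.length_pos_of_ne_nil hi₁.1
    have l₂ := List.length_pos_of_ne_nil hi₂.1
    have hlt : i₁ ++ i₂ < i₂ := hi.2 i₁ i₂ rfl hi₁.1 hi₂.1
    -- one factor starts with `i₁`
    have key : ∀ {u₁ u₂ v z : List α}, ¬ u₁ < i₁ → u₁.length ≤ i₁.length →
        u₁ ++ u₂ < i₁ ++ i₂ → v < i₁ ++ i₂ → IsShuffle u₂ v z →
        u₁ = i₁ ∧ i₁ ++ z < i₁ ++ i₂ := by
      intro u₁ u₂ v z h₁ hl hu hv h
      rcases lt_or_eq_of_le (not_lt.1 h₁) with h₁ | rfl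
      · exact absurd (append_lt_append_of_lt i₂ u₂ h₁ hl) (lt_asymm hu)
      · rw [append_lt_append_left_iff] at hu ⊢
        exact ⟨rfl, ih _ (by simp; omega) hi₂ hu (hv.trans hlt) h rfl⟩
    by_cases hz : i₁.length ≤ z.length
    · rw [← List.take_append_drop i₁.length z] at h ⊢
      have hl : (z.take i₁.length).length = i₁.length := by simp [hz]
      generalize z.take i₁.length = z₁ at *
      generalize z.drop i₁.length = z₂ at *
      obtain ⟨u₁, u₂, v₁, v₂, rfl, rfl, h₁, h₂⟩ := h.split
      have hlen := h₁.length_eq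
      by_cases hu₁ : u₁ < i₁
      · by_cases hv₁ : v₁ < i₁
        · exact append_lt_append_of_lt _ _
            (ih _ (by simp; omega) hi₁ hu₁ hv₁ h₁ rfl) hl.ge
        · by_cases hu0 : u₁ = []
          · subst hu0
            obtain ⟨rfl, hr⟩ := key hv₁ (by omega) hv hu h₂.symm
            rwa [h₁.eq_of_nil_left]
          · have := List.length_pos_of_ne_nil hu0
            have hvi : v₁ = i₁ := by
              by_contra hne
              exact lt_asymm hv (append_lt_append_of_lt _ _
                (lt_of_le_of_ne (not_lt.1 hv₁) (Ne.symm hne)) (by omega))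
            subst hvi; omega
      · by_cases hv0 : v₁ = []
        · subst hv0
          obtain ⟨rfl, hr⟩ := key hu₁ (by omega) hu hv h₂
          rwa [h₁.symm.eq_of_nil_left]
        · have := List.length_pos_of_ne_nil hv0
          have hvi : u₁ = i₁ := by
            by_contra hne
            exact lt_asymm hu (append_lt_append_of_lt _ _
              (lt_of_le_of_ne (not_lt.1 hu₁) (Ne.symm hne)) (by omega))
          subst hvi; omega
    · have hlen := h.length_eq
      have aux : ∀ {u : List α}, u.length < i₁.length → u < i₁ ++ i₂ → u < i₁ := by
        intro u hl hu
        by_contra hne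
        have hne' : i₁ ≠ u := by rintro rfl; omega
        refine lt_asymm hu ?_
        simpa using append_lt_append_of_lt i₂ [] (lt_of_le_of_ne (not_lt.1 hne) hne') hl.le
      exact (ih _ (by simp; omega) hi₁ (aux (by omega) hu) (aux (by omega) hv) h rfl).trans
        (lt_append_of_ne_nil _ hi₂.1)
  · obtain ⟨x, rfl⟩ : ∃ x, i = [x] := by
      rw [← List.length_eq_one_iff]
      have := List.length_pos_of_ne_nil hi.1
      omega
    cases h with
    | nil => exact hu
    | left a _ => simpa [List.cons_lt_cons_iff] using hu
    | right a _ => simpa [List.cons_lt_cons_iff] using hv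

/-- A nontrivial shuffle of prefixes of words not exceeding a Lyndon word is smaller. -/
theorem Lyndon.shuffle_ne {i : List α} (hi : Lyndon i) {u v : List α} (hu : u < i)
    (hv : v < i) : ¬ IsShuffle u v i := fun h => lt_irrefl _ (hi.shuffle_lt hu hv h)

/-- Words of length `m * i.length` which are at most the `m`-th power of `i`. -/
def BelowPow (i : List α) : ℕ → List α → Prop
  | 0, w => w = []
  | m + 1, w => (w.length = (m + 1) * i.length ∧ w < i) ∨ ∃ w', w = i ++ w' ∧ BelowPow i m w'

theorem BelowPow.length_eq {i : List α} : ∀ {m : ℕ} {w : List α}, BelowPow i m w →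
    w.length = m * i.length
  | 0, _, h => by simp [show _ = [] from h]
  | _ + 1, _, .inl h => h.1
  | m + 1, _, .inr ⟨w', h, h'⟩ => by
    rw [h, List.length_append, h'.length_eq]; ring

theorem BelowPow.prefix_cases {i : List α} {m : ℕ} {u v : List α}
    (h : BelowPow i (m + 1) (u ++ v)) (hu : u.length ≤ i.length) :
    u < i ∨ u = i ∧ BelowPow i m v := by
  rcases h with h | ⟨w', h, h'⟩
  · exact .inl (prefix_lt h.2)
  · obtain ⟨t, rfl⟩ : u <+: i :=
      List.prefix_of_prefix_length_le (List.prefix_append u v) (h ▸ List.prefix_append i w') hu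
    rcases eq_or_ne t [] with rfl | ht
    · right
      simp only [List.append_nil, List.append_cancel_left_eq] at h h'
      subst h
      simpa using h'
    · exact .inl (lt_append_of_ne_nil u ht)

theorem Lyndon.belowPow_shuffle {i : List α} (hi : Lyndon i) : ∀ {m : ℕ} {w z : List α},
    BelowPow i m w → IsShuffle w i z → BelowPow i (m + 1) z
  | 0, w, z, hw, h => by
    obtain rfl : w = [] := hw
    exact .inr ⟨[], by simp [h.eq_of_nil_left], rfl⟩
  | m + 1, w, z, hw, h => by
    have hlen := h.length_eq
    have hwl := hw.length_eq
    obtain ⟨z₁, z₂, rfl, hz⟩ := exists_split_of_le_length (z := z) (k := i.length) (by omega)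
    obtain ⟨u₁, u₂, v₁, v₂, rfl, hv, h₁, h₂⟩ := h.split
    have hl₁ := h₁.length_eq
    rcases hw.prefix_cases (by omega) with hu | ⟨rfl, hu⟩
    · rcases eq_or_ne v₂ [] with rfl | hne
      · obtain rfl : i = v₁ := by simpa using hv
        obtain rfl : u₁ = [] := List.length_eq_zero_iff.1 (by omega)
        refine .inr ⟨u₂, ?_, by simpa using hw⟩
        rw [h₁.eq_of_nil_left, h₂.symm.eq_of_nil_left]
      · have hv₁ : v₁ < i := hv ▸ lt_append_of_ne_nil v₁ hne
        refine .inl ⟨by rw [hlen, hwl]; ring, ?_⟩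
        simpa using append_lt_append_of_lt z₂ [] (hi.shuffle_lt hu hv₁ h₁) hz.ge
    · obtain rfl : v₁ = [] := List.length_eq_zero_iff.1 (by omega)
      obtain rfl : u₁ = v₂ := by simpa using hv
      exact .inr ⟨z₂, by rw [h₁.symm.eq_of_nil_left], hi.belowPow_shuffle hu h₂⟩

theorem Lyndon.shuffle_belowPow_le {i : List α} (hi : Lyndon i) {j : List α} (hj : j < i) :
    ∀ {m : ℕ} {w z : List α}, BelowPow i m w → IsShuffle j w z →
      z ≤ (List.replicate m i).flatten ++ j
  | 0, w, z, hw, h => by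
    obtain rfl : w = [] := hw
    simp [h.symm.eq_of_nil_left]
  | m + 1, w, z, hw, h => by
    have hlen := h.length_eq
    have hwl := hw.length_eq
    obtain ⟨z₁, z₂, rfl, hz⟩ := exists_split_of_le_length (z := z) (k := i.length)
      (by rw [hlen, hwl, Nat.add_mul]; omega)
    obtain ⟨u₁, u₂, v₁, v₂, rfl, rfl, h₁, h₂⟩ := h.split
    have hl₁ := h₁.length_eq
    rw [List.replicate_succ, List.flatten_cons, List.append_assoc]
    rcases hw.prefix_cases (by omega) with hv | ⟨rfl, hv⟩
    · exact (append_lt_append_of_lt _ _ (hi.shuffle_lt (prefix_lt hj) hv h₁) hz.ge).le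
    · obtain rfl : u₁ = [] := List.length_eq_zero_iff.1 (by omega)
      have := hi.shuffle_belowPow_le (by simpa using hj) hv h₂
      rw [h₁.eq_of_nil_left]
      rw [List.nil_append]
      rw [le_iff_lt_or_eq] at this ⊢
      rwa [append_lt_append_left_iff, List.append_cancel_left_eq]

end Lex

section Strip
variable {α M : Type*} [DecidableEq α] [AddCommMonoid M]

/-- `g x'` if `x = c :: x'`, and `0` otherwise. -/
def onTail (c : α) (x : List α) (g : List α → M) : M :=
  match x with
  | [] => 0
  | a :: x' => if a = c then g x' else 0

/-- `g p` if `x = p ++ s`, and `0` otherwise. -/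
def onPrefix (s x : List α) (g : List α → M) : M :=
  if s <:+ x then g (x.take (x.length - s.length)) else 0

@[simp] theorem onTail_nil (c : α) (g : List α → M) : onTail c [] g = 0 := rfl

@[simp] theorem onTail_cons (c a : α) (x : List α) (g : List α → M) :
    onTail c (a :: x) g = if a = c then g x else 0 := rfl

theorem onPrefix_append (p s : List α) (g : List α → M) : onPrefix s (p ++ s) g = g p := by
  simp [onPrefix]

theorem onPrefix_of_not_suffix {s x : List α} (h : ¬ s <:+ x) (g : List α → M) :
    onPrefix s x g = 0 := if_neg h

theorem onPrefix_congr {s x : List α} {g h : List α → M} (H : ∀ p, x = p ++ s → g p = h p) :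
    onPrefix s x g = onPrefix s x h := by
  by_cases hs : s <:+ x
  · obtain ⟨p, rfl⟩ := hs
    simp only [onPrefix_append, H p rfl]
  · simp only [onPrefix_of_not_suffix hs]

theorem onTail_congr {c : α} {x : List α} {g h : List α → M}
    (H : ∀ x', x = c :: x' → g x' = h x') : onTail c x g = onTail c x h := by
  cases x with
  | nil => rfl
  | cons a x =>
    by_cases hac : a = c
    · subst hac; simp [H x rfl]
    · simp [hac]

theorem onPrefix_add (s x : List α) (g h : List α → M) :
    onPrefix s x (fun p => g p + h p) = onPrefix s x g + onPrefix s x h := by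
  unfold onPrefix; split_ifs <;> simp

theorem onTail_add (c : α) (x : List α) (g h : List α → M) :
    onTail c x (fun p => g p + h p) = onTail c x g + onTail c x h := by
  cases x with
  | nil => simp
  | cons a x => by_cases h : a = c <;> simp [h]

theorem onTail_onPrefix_comm (c : α) (s x y : List α) (g : List α → List α → M) :
    onTail c x (fun x' => onPrefix s y (g x')) =
      onPrefix s y (fun p => onTail c x (fun x' => g x' p)) := by
  cases x with
  | nil => simp [onPrefix]
  | cons a x => by_cases h : a = c <;> simp [h, onPrefix]

theorem onTail_onPrefix_self (c : α) {s : List α} (hs : s ≠ []) (x : List α)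
    (g : List α → M) :
    onTail c x (fun x' => onPrefix s x' g) = onPrefix s x (fun p => onTail c p g) := by
  by_cases hsx : s <:+ x
  · obtain ⟨p, rfl⟩ := hsx
    rw [onPrefix_append]
    cases p with
    | nil =>
      cases s with
      | nil => exact absurd rfl hs
      | cons a s =>
        have : ¬ a :: s <:+ s := fun h => by simpa using h.length_le
        simp [onPrefix_of_not_suffix this]
    | cons a p => simp [onPrefix_append]
  · rw [onPrefix_of_not_suffix hsx]
    cases x with
    | nil => rfl
    | cons a x =>
      have : ¬ s <:+ x := fun h => hsx (h.trans (List.suffix_cons a x))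
      simp [onPrefix_of_not_suffix this]

end Strip

section Coeff
variable {n : ℕ}

theorem wt_append (u v : List (Fin (n+2))) : wt n (u ++ v) = wt n u + wt n v := by
  ext k; simp [wt]

theorem bil_add_left (a b c : Fin (n+2) → ℕ) : bil n (a + b) c = bil n a c + bil n b c := by
  simp only [bil, ← Finset.sum_add_distrib, Pi.add_apply]
  refine Finset.sum_congr rfl fun _ _ => Finset.sum_congr rfl fun _ _ => ?_
  push_cast; ring

theorem bil_add_right (a b c : Fin (n+2) → ℕ) : bil n a (b + c) = bil n a b + bil n a c := by
  simp only [bil, ← Finset.sum_add_distrib, Pi.add_apply]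
  refine Finset.sum_congr rfl fun _ _ => Finset.sum_congr rfl fun _ _ => ?_
  push_cast; ring

/-- The scalar picked up when the word `v` is moved past the word `u`. -/
noncomputable def braid (n : ℕ) (u v : List (Fin (n+2))) : Kq :=
  (-1 : Kq) ^ (pw n u * pw n v) * qX ^ (-(bil n (wt n u) (wt n v)))

theorem qX_ne_zero : qX ≠ 0 := RatFunc.X_ne_zero

theorem braid_append_left (u v w : List (Fin (n+2))) :
    braid n (u ++ v) w = braid n u w * braid n v w := by
  simp only [braid, wt_append, bil_add_left, neg_add, zpow_add₀ qX_ne_zero, pw,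
    List.map_append, List.sum_append, add_mul, pow_add]
  ring

theorem braid_append_right (u v w : List (Fin (n+2))) :
    braid n u (v ++ w) = braid n u v * braid n u w := by
  simp only [braid, wt_append, bil_add_right, neg_add, zpow_add₀ qX_ne_zero, pw,
    List.map_append, List.sum_append, mul_add, pow_add]
  ring

theorem braid_cons_right (u v : List (Fin (n+2))) (a : Fin (n+2)) :
    braid n u (a :: v) = braid n u [a] * braid n u v := braid_append_right u [a] v

theorem braid_nil_left (v : List (Fin (n+2))) : braid n [] v = 1 := by
  have : wt n [] = 0 := by ext; simp [wt]
  simp [braid, pw, bil, this]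

theorem braid_nil_right (v : List (Fin (n+2))) : braid n v [] = 1 := by
  have : wt n [] = 0 := by ext; simp [wt]
  simp [braid, pw, bil, this]

theorem braid_reverse (u v : List (Fin (n+2))) :
    braid n u.reverse v.reverse = braid n u v := by
  have (w : List (Fin (n+2))) : wt n w.reverse = wt n w := by ext; simp [wt]
  simp [braid, this, pw, List.map_reverse, List.sum_reverse]

theorem mapDomain_cons_apply (a c : Fin (n+2)) (f : F n) (z : List (Fin (n+2))) :
    Finsupp.mapDomain (List.cons a) f (c :: z) = if a = c then f z else 0 := by
  split_ifs with h
  · subst h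
    exact Finsupp.mapDomain_apply (List.cons_injective) f z
  · exact Finsupp.mapDomain_of_notMem_range _ _ (by rintro ⟨_, hh⟩; simp at hh; exact h hh.1)

theorem shAux_nil_left (y : List (Fin (n+2))) : shAux n [] y = Finsupp.single y 1 := by
  simp [shAux]

theorem shAux_nil_right (x : List (Fin (n+2))) : shAux n x [] = Finsupp.single x 1 := by
  cases x <;> simp [shAux]

theorem shAux_cons_cons (i j : Fin (n+2)) (x y : List (Fin (n+2))) :
    shAux n (i :: x) (j :: y) = Finsupp.mapDomain (List.cons i) (shAux n x (j :: y))
      + braid n (i :: x) [j] • Finsupp.mapDomain (List.cons j) (shAux n (i :: x) y) := by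
  rw [shAux]
  simp [braid, pw]

theorem shAux_apply_nil (x y : List (Fin (n+2))) :
    shAux n x y [] = if x = [] ∧ y = [] then 1 else 0 := by
  rcases x with _ | ⟨i, x⟩
  · simp [shAux_nil_left, Finsupp.single_apply]
  rcases y with _ | ⟨j, y⟩
  · simp [shAux_nil_right]
  have (a : Fin (n+2)) (f : F n) : Finsupp.mapDomain (List.cons a) f [] = 0 :=
    Finsupp.mapDomain_of_notMem_range _ _ (by simp)
  simp [shAux_cons_cons, this]

theorem shAux_apply_cons (x y : List (Fin (n+2))) (c : Fin (n+2)) (z : List (Fin (n+2))) :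
    shAux n x y (c :: z) = onTail c x (fun x' => shAux n x' y z) +
      onTail c y (fun y' => braid n x [c] * shAux n x y' z) := by
  rcases x with _ | ⟨i, x⟩
  · rcases y with _ | ⟨j, y⟩
    · simp [shAux_nil_left, Finsupp.single_apply]
    · by_cases h : j = c <;>
        simp [shAux_nil_left, Finsupp.single_apply, braid_nil_left, h]
  rcases y with _ | ⟨j, y⟩
  · by_cases h : i = c <;> simp [shAux_nil_right, Finsupp.single_apply, h]
  rw [shAux_cons_cons, Finsupp.add_apply, Finsupp.smul_apply, mapDomain_cons_apply,
    mapDomain_cons_apply]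
  by_cases h : j = c
  · subst h; simp
  · simp [h]

theorem isShuffle_of_shAux_ne_zero {x y z : List (Fin (n+2))} (h : shAux n x y z ≠ 0) :
    IsShuffle x y z := by
  induction z generalizing x y with
  | nil =>
    rw [shAux_apply_nil] at h
    obtain ⟨rfl, rfl⟩ : x = [] ∧ y = [] := by simpa using h
    exact .nil
  | cons c z ih =>
    rw [shAux_apply_cons] at h
    by_cases h₁ : onTail c x (fun x' => shAux n x' y z) = 0
    · rw [h₁, zero_add] at h
      rcases y with _ | ⟨b, y⟩
      · simp at h
      · by_cases hb : b = c
        · subst hb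
          simp only [onTail_cons, if_true] at h
          exact (ih (right_ne_zero_of_mul h)).right b
        · simp [hb] at h
    · rcases x with _ | ⟨b, x⟩
      · simp at h₁
      · by_cases hb : b = c
        · subst hb
          simp only [onTail_cons, if_true] at h₁
          exact (ih h₁).left b
        · simp [hb] at h₁

theorem onPrefix_eq_ite (s y r : List (Fin (n+2))) :
    onPrefix s y (fun p => if p = r then (1 : Kq) else 0) = if y = r ++ s then 1 else 0 := by
  by_cases hs : s <:+ y
  · obtain ⟨p, rfl⟩ := hs
    simp [onPrefix_append]
  · rw [onPrefix_of_not_suffix hs, if_neg]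
    rintro rfl
    exact hs (List.suffix_append r s)

/-- If `s` is not a nontrivial shuffle of suffixes of `x` and `y`, then the coefficient of
`r ++ s` is computed by taking `s` off one of the two factors. -/
theorem shAux_apply_append {s : List (Fin (n+2))} (hs : s ≠ []) (r : List (Fin (n+2))) :
    ∀ {x y : List (Fin (n+2))},
    (∀ x₁ y₁, x₁ ≠ [] → y₁ ≠ [] → x₁ <:+ x → y₁ <:+ y → shAux n x₁ y₁ s = 0) →
    shAux n x y (r ++ s) = onPrefix s x (fun p => braid n s y * shAux n p y r) +
      onPrefix s y (fun p => shAux n x p r) := by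
  induction r with
  | nil =>
    intro x y H
    rcases eq_or_ne x [] with rfl | hx
    · have : ¬ s <:+ [] := by simpa using hs
      rw [onPrefix_of_not_suffix this]
      simp only [shAux_apply_nil, true_and, onPrefix_eq_ite]
      simp [shAux_nil_left, Finsupp.single_apply]
    rcases eq_or_ne y [] with rfl | hy
    · have : ¬ s <:+ [] := by simpa using hs
      rw [onPrefix_of_not_suffix this]
      simp only [shAux_apply_nil, and_true, onPrefix_eq_ite, braid_nil_right, one_mul]
      simp [shAux_nil_right, Finsupp.single_apply]
    · rw [List.nil_append, H x y hx hy List.suffix_rfl List.suffix_rfl]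
      simp [shAux_apply_nil, hx, hy, onPrefix]
  | cons c r ih =>
    intro x y H
    rw [List.cons_append, shAux_apply_cons]
    have h₁ : onTail c x (fun x' => shAux n x' y (r ++ s)) =
        onTail c x (fun x' => onPrefix s x' (fun p => braid n s y * shAux n p y r) +
          onPrefix s y (fun p => shAux n x' p r)) := by
      refine onTail_congr ?_
      rintro x' rfl
      exact ih fun x₁ y₁ hx hy hx' hy' =>
        H x₁ y₁ hx hy (hx'.trans (List.suffix_cons c x')) hy'
    have h₂ : onTail c y (fun y' => braid n x [c] * shAux n x y' (r ++ s)) =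
        onTail c y (fun y' =>
          onPrefix s x (fun p => braid n s y * (braid n p [c] * shAux n p y' r)) +
          onPrefix s y' (fun p => braid n x [c] * shAux n x p r)) := by
      refine onTail_congr ?_
      rintro y' rfl
      rw [ih fun x₁ y₁ hx hy hx' hy' =>
        H x₁ y₁ hx hy hx' (hy'.trans (List.suffix_cons c y')), mul_add]
      congr 1
      · unfold onPrefix
        split_ifs with h
        · obtain ⟨p, rfl⟩ := h
          simp only [List.length_append, Nat.add_sub_cancel, List.take_left]
          rw [braid_append_left, braid_cons_right s y' c]
          ring
        · simp
      · unfold onPrefix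
        split_ifs <;> simp
    have h₃ (p : List (Fin (n+2))) : onTail c x (fun x' => shAux n x' p r) +
        onTail c p (fun y' => braid n x [c] * shAux n x y' r) = shAux n x p (c :: r) :=
      (shAux_apply_cons x p c r).symm
    have h₄ (p : List (Fin (n+2))) : onTail c p (fun p' => braid n s y * shAux n p' y r) +
        onTail c y (fun y' => braid n s y * (braid n p [c] * shAux n p y' r)) =
        braid n s y * shAux n p y (c :: r) := by
      rw [shAux_apply_cons, mul_add]
      congr 1
      · cases p <;> simp
      · cases y <;> simp
    rw [h₁, h₂, onTail_add, onTail_add, onTail_onPrefix_self c hs, onTail_onPrefix_self c hs,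
      onTail_onPrefix_comm, onTail_onPrefix_comm, add_add_add_comm, ← onPrefix_add,
      add_comm (onPrefix s y _), ← onPrefix_add]
    simp only [h₄]
    congr 1
    refine onPrefix_congr fun p _ => ?_
    rw [add_comm]
    exact h₃ p
theorem shw_apply (x y z : List (Fin (n+2))) :
    shw n x y z = shAux n x.reverse y.reverse z.reverse := by
  conv_lhs => rw [shw, ← List.reverse_reverse z]
  exact Finsupp.mapDomain_apply List.reverse_injective _ _

theorem isShuffle_of_shw_ne_zero {x y z : List (Fin (n+2))} (h : shw n x y z ≠ 0) :
    IsShuffle x y z := by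
  rw [shw_apply] at h
  simpa using (isShuffle_of_shAux_ne_zero h).reverse

theorem shw_nil_left_apply (y z : List (Fin (n+2))) :
    shw n [] y z = if y = z then 1 else 0 := by
  simp [shw_apply, shAux_nil_left, Finsupp.single_apply]

theorem shw_nil_right_apply (x z : List (Fin (n+2))) :
    shw n x [] z = if x = z then 1 else 0 := by
  simp [shw_apply, shAux_nil_right, Finsupp.single_apply]

theorem shw_apply_append {i u v : List (Fin (n+2))} (hi : i ≠ []) (z : List (Fin (n+2)))
    (H : ∀ u₁ v₁, u₁ ≠ [] → v₁ ≠ [] → u₁ <+: u → v₁ <+: v → ¬ IsShuffle u₁ v₁ i) :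
    shw n u v (i ++ z) =
      onPrefix i.reverse u.reverse
        (fun p => braid n i v * shAux n p v.reverse z.reverse) +
      onPrefix i.reverse v.reverse (fun p => shAux n u.reverse p z.reverse) := by
  rw [shw_apply, List.reverse_append, shAux_apply_append (by simpa using hi), braid_reverse]
  intro x₁ y₁ hx hy hx' hy'
  by_contra h
  refine H x₁.reverse y₁.reverse (by simpa using hx) (by simpa using hy) ?_ ?_ ?_
  · rwa [← List.reverse_suffix, List.reverse_reverse]
  · rwa [← List.reverse_suffix, List.reverse_reverse]
  · simpa using (isShuffle_of_shAux_ne_zero h).reverse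

theorem onPrefix_reverse_eq_zero {i u : List (Fin (n+2))} (h : ¬ i <+: u)
    (g : List (Fin (n+2)) → Kq) : onPrefix i.reverse u.reverse g = 0 :=
  onPrefix_of_not_suffix (by rwa [List.reverse_suffix]) g

theorem onPrefix_reverse_append (i u : List (Fin (n+2))) (g : List (Fin (n+2)) → Kq) :
    onPrefix i.reverse (i ++ u).reverse g = g u.reverse := by
  rw [List.reverse_append, onPrefix_append]

theorem rep_succ (m : ℕ) (w : List (Fin (n+2))) : rep n (m + 1) w = w ++ rep n m w := by
  simp [rep, List.replicate_succ]

theorem not_prefix_of_lt {i u : List (Fin (n+2))} (h : u < i) : ¬ i <+: u := by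
  rintro ⟨t, rfl⟩
  exact lt_irrefl _ (prefix_lt h)

theorem lt_of_prefix {i u v : List (Fin (n+2))} (h : v < i) (hu : u <+: v) : u < i := by
  obtain ⟨t, rfl⟩ := hu
  exact prefix_lt h

theorem shw_apply_rep_append {i j : List (Fin (n+2))} (hi : Lyndon i) (hj : j < i) :
    ∀ {m : ℕ} {w : List (Fin (n+2))}, BelowPow i m w →
      shw n j w (rep n m i ++ j) = if w = rep n m i then 1 else 0
  | 0, w, hw => by
    obtain rfl : w = [] := hw
    simp [rep, shw_nil_right_apply]
  | m + 1, w, hw => by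
    rw [rep_succ, List.append_assoc, shw_apply_append hi.1, onPrefix_reverse_eq_zero
      (not_prefix_of_lt hj), zero_add]
    · rcases hw with hw | ⟨w', rfl, hw⟩
      · rw [onPrefix_reverse_eq_zero (not_prefix_of_lt hw.2), if_neg]
        rintro rfl
        exact not_prefix_of_lt hw.2 (List.prefix_append _ _)
      · rw [onPrefix_reverse_append, ← shw_apply, shw_apply_rep_append hi hj hw]
        simp
    · rintro u₁ v₁ hu hv hu' ⟨t, rfl⟩ h
      have hl := h.length_eq
      have := List.length_pos_of_ne_nil hu
      rcases hw.prefix_cases (by omega) with hv | ⟨rfl, -⟩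
      · exact hi.shuffle_ne (lt_of_prefix hj hu') hv h
      · omega

theorem shw_apply_rep_succ {i : List (Fin (n+2))} (hi : Lyndon i) :
    ∀ {m : ℕ} {w : List (Fin (n+2))}, BelowPow i m w →
      shw n w i (rep n (m + 1) i) =
        if w = rep n m i then ∑ l ∈ Finset.range (m + 1), braid n i i ^ l else 0
  | 0, w, hw => by
    obtain rfl : w = [] := hw
    simp [rep, shw_nil_left_apply]
  | m + 1, w, hw => by
    rw [rep_succ, shw_apply_append hi.1]
    · have h₁ := onPrefix_reverse_append i []
        (fun p => shAux n w.reverse p (rep n (m + 1) i).reverse)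
      rw [List.append_nil, ← shw_apply, shw_nil_right_apply] at h₁
      rw [h₁]
      rcases hw with hw | ⟨w', rfl, hw⟩
      · have : w ≠ rep n (m + 1) i := by
          rintro rfl
          rw [rep_succ] at hw
          exact not_prefix_of_lt hw.2 (List.prefix_append _ _)
        rw [onPrefix_reverse_eq_zero (not_prefix_of_lt hw.2), if_neg this, if_neg this, zero_add]
      · rw [onPrefix_reverse_append, ← shw_apply, shw_apply_rep_succ hi hw, rep_succ]
        simp only [List.append_cancel_left_eq]
        split_ifs
        · rw [Finset.sum_range_succ' _ (m + 1), Finset.mul_sum]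
          simp [pow_succ']
        · simp
    · rintro u₁ v₁ hu hv ⟨t, rfl⟩ hv' h
      have hl := h.length_eq
      have := List.length_pos_of_ne_nil hu
      have := List.length_pos_of_ne_nil hv
      rcases hw.prefix_cases (by omega) with hu | ⟨rfl, -⟩
      · refine hi.shuffle_ne hu ?_ h
        obtain ⟨s, hs⟩ := hv'
        have hs0 : s ≠ [] := by
          rintro rfl
          rw [List.append_nil] at hs
          subst hs
          omega
        exact hs ▸ lt_append_of_ne_nil v₁ hs0
      · omega

theorem diam_single_left_apply (j : List (Fin (n+2))) (u : F n) (z : List (Fin (n+2))) :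
    diam n (Finsupp.single j 1) u z = ∑ w ∈ u.support, u w * shw n j w z := by
  rw [diam, Finsupp.sum_single_index (by simp)]
  simp [Finsupp.sum, Finsupp.finsetSum_apply]

theorem diam_single_right_apply (j : List (Fin (n+2))) (u : F n) (z : List (Fin (n+2))) :
    diam n u (Finsupp.single j 1) z = ∑ w ∈ u.support, u w * shw n w j z := by
  rw [diam, Finsupp.sum, Finsupp.finsetSum_apply]
  refine Finset.sum_congr rfl fun w _ => ?_
  rw [Finsupp.sum_single_index (by simp)]
  simp

theorem belowPow_of_mem_support_shPow {i : List (Fin (n+2))} (hi : Lyndon i) :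
    ∀ {m : ℕ} {w : List (Fin (n+2))}, w ∈ (shPow n i m).support → BelowPow i m w
  | 0, w, hw => by
    by_contra h
    rw [Finsupp.mem_support_iff, shPow, Finsupp.single_apply, if_neg (Ne.symm h)] at hw
    exact hw rfl
  | m + 1, w, hw => by
    rw [Finsupp.mem_support_iff, shPow, diam_single_right_apply] at hw
    obtain ⟨v, hv, hne⟩ := Finset.exists_ne_zero_of_sum_ne_zero hw
    exact hi.belowPow_shuffle (belowPow_of_mem_support_shPow hi hv)
      (isShuffle_of_shw_ne_zero (right_ne_zero_of_mul hne))

theorem sum_support_mul_ite (u : F n) (w : List (Fin (n+2))) (a : Kq) :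
    ∑ v ∈ u.support, u v * (if v = w then a else 0) = u w * a := by
  simp only [mul_ite, mul_zero, Finset.sum_ite_eq', Finsupp.mem_support_iff]
  split_ifs with h
  · rfl
  · rw [Finsupp.notMem_support_iff.1 (by simpa using h), zero_mul]

theorem shPow_apply_rep {i : List (Fin (n+2))} (hi : Lyndon i) (m : ℕ) :
    shPow n i m (rep n m i) =
      ∏ k ∈ Finset.range m, ∑ l ∈ Finset.range (k + 1), braid n i i ^ l := by
  induction m with
  | zero => simp [shPow, rep]
  | succ m ih =>
    rw [shPow, diam_single_right_apply, Finset.prod_range_succ, ← ih,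
      ← sum_support_mul_ite]
    exact Finset.sum_congr rfl fun w hw => by
      rw [shw_apply_rep_succ hi (belowPow_of_mem_support_shPow hi hw)]

theorem bil_self (μ : Fin (n+2) → ℕ) : bil n μ μ =
    2 * ((μ 0 : ℤ) ^ 2 + ∑ k : Fin (n+1), ((μ k.castSucc : ℤ) - μ k.succ) ^ 2) := by
  have h (a b : Fin (n+2)) : cart n a b = (if a = b then 4 else 0)
      - (if a = b then if a = Fin.last (n+1) then 2 else 0 else 0)
      - (if (a : ℕ) + 1 = b then 2 else 0) - (if (b : ℕ) + 1 = a then 2 else 0) := by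
    unfold cart
    simp only [Fin.ext_iff, Fin.val_last]
    split_ifs <;> omega
  have h₁ : ∑ a : Fin (n+2), ∑ b : Fin (n+2), (μ a : ℤ) * μ b *
      (if (a : ℕ) + 1 = b then 2 else 0) =
      ∑ k : Fin (n+1), 2 * ((μ k.castSucc : ℤ) * μ k.succ) := by
    rw [Fin.sum_univ_castSucc]
    have : ∑ b : Fin (n+2), (μ (Fin.last (n+1)) : ℤ) * μ b *
        (if ((Fin.last (n+1) : Fin (n+2)) : ℕ) + 1 = b then 2 else 0) = 0 := by
      refine Finset.sum_eq_zero fun b _ => ?_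
      have := b.2
      rw [if_neg (by simp; omega), mul_zero]
    rw [this, add_zero]
    refine Finset.sum_congr rfl fun k _ => ?_
    rw [Finset.sum_eq_single k.succ]
    · simp; ring
    · intro b _ hb
      rw [if_neg, mul_zero]
      intro hk
      exact hb (Fin.ext (by simpa using hk.symm))
    · simp
  have h₂ : ∑ a : Fin (n+2), ∑ b : Fin (n+2), (μ a : ℤ) * μ b *
      (if (b : ℕ) + 1 = a then 2 else 0) =
      ∑ k : Fin (n+1), 2 * ((μ k.castSucc : ℤ) * μ k.succ) := by
    rw [Finset.sum_comm, ← h₁]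
    refine Finset.sum_congr rfl fun _ _ => Finset.sum_congr rfl fun _ _ => ?_
    ring
  have h₃ := Fin.sum_univ_castSucc fun a => (μ a : ℤ) ^ 2
  have h₄ := Fin.sum_univ_succ fun a => (μ a : ℤ) ^ 2
  simp only [bil, h, mul_sub, Finset.sum_sub_distrib, h₁, h₂]
  simp only [mul_ite, mul_zero, Finset.sum_ite_eq, Finset.mem_univ, if_true, sub_sq,
    Finset.sum_add_distrib, Finset.sum_sub_distrib, Finset.sum_ite_eq']
  simp only [← pow_two, ← Finset.sum_mul, mul_assoc, ← Finset.mul_sum]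
  linarith

theorem bil_wt_self_pos {w : List (Fin (n+2))} (hw : w ≠ []) : 0 < bil n (wt n w) (wt n w) := by
  rw [bil_self]
  have hs : ∀ k ∈ (Finset.univ : Finset (Fin (n+1))),
      0 ≤ ((wt n w k.castSucc : ℤ) - wt n w k.succ) ^ 2 := fun _ _ => sq_nonneg _
  have hnn := Finset.sum_nonneg hs
  by_contra h
  have h0 : wt n w 0 = 0 := by
    have := sq_nonneg (wt n w 0 : ℤ)
    have : (wt n w 0 : ℤ) ^ 2 = 0 := by linarith
    simpa using this
  have hsum : ∑ k : Fin (n+1), ((wt n w k.castSucc : ℤ) - wt n w k.succ) ^ 2 = 0 := by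
    have := sq_nonneg (wt n w 0 : ℤ)
    linarith
  rw [Finset.sum_eq_zero_iff_of_nonneg hs] at hsum
  have hall (a : Fin (n+2)) : wt n w a = 0 := by
    induction a using Fin.induction with
    | zero => exact h0
    | succ k ih =>
      have := pow_eq_zero_iff (two_ne_zero) |>.1 (hsum k (Finset.mem_univ k))
      omega
  obtain ⟨a, l, rfl⟩ := List.exists_cons_of_ne_nil hw
  simpa [wt] using hall a

theorem qX_zpow_ne_one {k : ℤ} (hk : 0 < k) : qX ^ k ≠ 1 := by
  intro h
  obtain ⟨m, rfl⟩ := Int.eq_ofNat_of_zero_le hk.le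
  rw [zpow_natCast, qX, ← RatFunc.algebraMap_X, ← map_pow,
    ← map_one (algebraMap (Polynomial ℚ) (RatFunc ℚ))] at h
  have h' := RatFunc.algebraMap_injective ℚ h
  have := congrArg Polynomial.natDegree h'
  simp at this
  omega

/-- The twist `(-1)^{p(w)} q_w⁻²` of a word with itself. -/
theorem braid_self (w : List (Fin (n+2))) :
    braid n w w = (-1 : Kq) ^ pw n w * (qI n w)⁻¹ ^ 2 := by
  have hb : bil n (wt n w) (wt n w) / 2 * 2 = bil n (wt n w) (wt n w) :=
    Int.ediv_mul_cancel ⟨_, bil_self _⟩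
  have h₁ : (qI n w)⁻¹ ^ 2 = qX ^ (-bil n (wt n w) (wt n w)) := by
    rw [qI, inv_pow, ← zpow_natCast, ← zpow_mul, zpow_neg]
    push_cast
    rw [hb]
  have h₂ : (-1 : Kq) ^ (pw n w * pw n w) = (-1 : Kq) ^ pw n w := by
    rw [neg_one_pow_eq_pow_mod_two, Nat.mul_mod, neg_one_pow_eq_pow_mod_two (pw n w)]
    rcases Nat.mod_two_eq_zero_or_one (pw n w) with h | h <;> simp [h]
  rw [braid, h₁, h₂]

theorem qI_ne_zero (w : List (Fin (n+2))) : qI n w ≠ 0 := zpow_ne_zero _ qX_ne_zero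

theorem qI_pow_ne_one {w : List (Fin (n+2))} (hw : w ≠ []) {k : ℕ} (hk : 0 < k) :
    qI n w ^ k ≠ 1 := by
  rw [qI, ← zpow_natCast, ← zpow_mul]
  refine qX_zpow_ne_one (mul_pos ?_ (by exact_mod_cast hk))
  have h₁ := bil_wt_self_pos hw
  have h₂ : (2 : ℤ) ∣ bil n (wt n w) (wt n w) := ⟨_, bil_self _⟩
  omega

theorem braid_self_pow_ne_one {w : List (Fin (n+2))} (hw : w ≠ []) {k : ℕ} (hk : 0 < k) :
    braid n w w ^ k ≠ 1 := by
  intro h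
  have h₁ : (braid n w w ^ k) ^ 2 = ((qI n w) ^ (4 * k))⁻¹ := by
    rw [braid_self, mul_pow, mul_pow, ← pow_mul, ← pow_mul, ← pow_mul, ← pow_mul,
      ((even_two.mul_left k).mul_left (pw n w)).neg_one_pow, one_mul, inv_pow]
    congr 2
    ring
  rw [h, one_pow, eq_comm, inv_eq_one] at h₁
  exact qI_pow_ne_one hw (by omega) h₁

theorem sum_braid_self_pow_ne_zero {w : List (Fin (n+2))} (hw : w ≠ []) (k : ℕ) :
    ∑ l ∈ Finset.range (k + 1), braid n w w ^ l ≠ 0 := by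
  intro h
  have := geom_sum_mul (braid n w w) (k + 1)
  rw [h, zero_mul, eq_comm, sub_eq_zero] at this
  exact braid_self_pow_ne_one hw k.succ_pos this

theorem sum_braid_self_pow {w : List (Fin (n+2))} (hw : w ≠ []) (k : ℕ) :
    ∑ l ∈ Finset.range (k + 1), braid n w w ^ l =
      (-1 : Kq) ^ (k * pw n w) * (qI n w)⁻¹ ^ k * qint n w (k + 1) := by
  have h0 := qI_ne_zero w
  have h4 := qI_pow_ne_one hw (k := 4) (by omega)
  have hb := braid_self_pow_ne_one hw (k := 1) one_pos
  rw [pow_one] at hb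
  rw [geom_sum_eq hb]
  rw [div_eq_iff (sub_ne_zero.2 hb), braid_self]
  unfold qint
  split_ifs with hp
  · have e : Even (pw n w) := Nat.even_iff.2 hp
    rw [e.neg_one_pow, (e.mul_left k).neg_one_pow]
    have hd : qI n w - (qI n w)⁻¹ ≠ 0 := by
      intro h
      refine h4 ?_
      have : qI n w * qI n w = 1 := by
        nth_rewrite 2 [sub_eq_zero.1 h]
        exact mul_inv_cancel₀ h0
      linear_combination (qI n w ^ 2 + 1) * this
    rw [one_mul, one_mul, mul_div_assoc', div_mul_eq_mul_div, eq_div_iff hd]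
    have e₁ : qI n w * (qI n w)⁻¹ = 1 := mul_inv_cancel₀ h0
    have hR : (qI n w)⁻¹ ^ k * qI n w ^ k = 1 := by rw [← mul_pow, inv_mul_cancel₀ h0, one_pow]
    rw [← pow_mul, mul_comm 2, pow_mul]
    simp only [pow_succ _ k]
    generalize (qI n w)⁻¹ ^ k = R at *
    generalize qI n w ^ k = Q at *
    generalize (qI n w)⁻¹ = r at *
    linear_combination (R ^ 2 * r - r) * e₁ - qI n w * (r ^ 2 - 1) * hR
  · have e : Odd (pw n w) := Nat.odd_iff.2 (by omega)
    rw [e.neg_one_pow, mul_comm k, pow_mul, e.neg_one_pow]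
    have hd : -qI n w - (qI n w)⁻¹ ≠ 0 := by
      intro h
      refine h4 ?_
      have : qI n w * qI n w = -1 := by
        nth_rewrite 2 [show qI n w = -(qI n w)⁻¹ by linear_combination -h]
        rw [mul_neg, mul_inv_cancel₀ h0]
      linear_combination (qI n w ^ 2 - 1) * this
    rw [mul_div_assoc', div_mul_eq_mul_div, eq_div_iff hd]
    have e₁ : qI n w * (qI n w)⁻¹ = 1 := mul_inv_cancel₀ h0
    have hR : ((-1 : Kq) ^ k) ^ 2 * (qI n w)⁻¹ ^ k * qI n w ^ k = 1 := by
      rw [← pow_mul, (even_two.mul_left k).neg_one_pow, one_mul, ← mul_pow,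
        inv_mul_cancel₀ h0, one_pow]
    rw [mul_pow (-1 : Kq), ← pow_mul (qI n w)⁻¹ 2, mul_comm 2, pow_mul (qI n w)⁻¹ (k + 1),
      neg_pow (qI n w)]
    simp only [pow_succ _ k]
    generalize (-1 : Kq) ^ k = s at *
    generalize (qI n w)⁻¹ ^ k = R at *
    generalize qI n w ^ k = Q at *
    generalize (qI n w)⁻¹ = r at *
    linear_combination (s * R ^ 2 * r - r) * e₁ - qI n w * (r ^ 2 + 1) * hR

end Coeff

/-- Let `𝐢` be a Lyndon word, `𝐣` a dominant word with `𝐢 ≻ 𝐣`,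
and `m > 0`.  Then `max(𝐣 ⋄ 𝐢^{⋄m}) = 𝐢^m 𝐣`, and the coefficient of `𝐢^m 𝐣` in
`𝐣 ⋄ 𝐢^{⋄m}` equals `(-1)^{m(m-1)p(𝐢)/2} q_𝐢^{-m(m-1)/2} [m]_𝐢!`. -/
theorem stmt13 (n m : ℕ) (hm : 0 < m) (i j : List (Fin (n+2)))
    (hi : IsLyndonW n i) (hj : IsDominant n j) (hij : wlt n j i) :
    IsMaxWord n (diam n (Finsupp.single j 1) (shPow n i m)) (rep n m i ++ j) ∧
    (diam n (Finsupp.single j 1) (shPow n i m)) (rep n m i ++ j)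
      = (-1 : Kq) ^ ((m * (m-1) / 2) * pw n i)
          * (qI n i) ^ (-((m * (m-1) / 2 : ℕ) : ℤ)) * qfact n i m := by
  have hL : Lyndon i := hi
  have hlt : j < i := hij
  have hcoef : diam n (Finsupp.single j 1) (shPow n i m) (rep n m i ++ j) =
      ∏ k ∈ Finset.range m, ∑ l ∈ Finset.range (k + 1), braid n i i ^ l := by
    rw [diam_single_left_apply, ← shPow_apply_rep hL, ← mul_one (shPow n i m (rep n m i)),
      ← sum_support_mul_ite]
    exact Finset.sum_congr rfl fun w hw => by
      rw [shw_apply_rep_append hL hlt (belowPow_of_mem_support_shPow hL hw)]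
  refine ⟨⟨?_, fun v hv => ?_⟩, ?_⟩
  · rw [Finsupp.mem_support_iff, hcoef]
    exact Finset.prod_ne_zero_iff.2 fun k _ => sum_braid_self_pow_ne_zero hL.1 k
  · rw [Finsupp.mem_support_iff, diam_single_left_apply] at hv
    obtain ⟨w, hw, hne⟩ := Finset.exists_ne_zero_of_sum_ne_zero hv
    exact (hL.shuffle_belowPow_le hlt (belowPow_of_mem_support_shPow hL hw)
      (isShuffle_of_shw_ne_zero (right_ne_zero_of_mul hne))).eq_or_lt
  · rw [hcoef]
    clear hm hcoef
    induction m with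
    | zero => simp [qfact]
    | succ m ih =>
      have hm : (m + 1) * (m + 1 - 1) / 2 = m * (m - 1) / 2 + m := Nat.triangle_succ m
      rw [Finset.prod_range_succ, ih, sum_braid_self_pow hL.1, hm, qfact, add_mul, pow_add,
        Nat.cast_add, neg_add, zpow_add₀ (qI_ne_zero i), zpow_neg _ (m : ℤ), zpow_natCast, inv_pow]
      ring

end SpinQHA
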